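/- There exist constants C > 0 and τ₀ ≥ 1, depending only on n and Ω, such that for every real τ with |τ| ≥ τ₀ and every u ∈ C_c^∞(Ω), the estimate |τ| · (∫_Ω |u(x)|² dx)^{1/2} ≤ C · (∫_Ω | (z̄(x))^{−τ} Δ(z̄^τ u)(x)|² dx)^{1/2} holds, where z̄(x) = x₁ − i·r(x) is the complex conjugate of z(x), (z̄)^τ is defined via the principal branch of the logarithm, and Δ(z̄^τ u) denotes the Euclidean Laplacian of x ↦ z̄(x)^τ u(x). -/

import Mathlib

open MeasureTheory Complex

noncomputable section

/-- `ℝⁿ` split as `ℝ × ℝ^{n-1}`. -/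
abbrev Spc (m : ℕ) := ℝ × EuclideanSpace ℝ (Fin m)

/-- `z̄(x) = x₁ - i |x'|`, the complex conjugate of `z(x) = x₁ + i |x'|`. -/
def zbf {m : ℕ} (x : Spc m) : ℂ := (x.1 : ℂ) - Complex.I * (‖x.2‖ : ℝ)

/-- The Euclidean Laplacian, as the sum of second directional derivatives along the
standard orthonormal basis of `ℝ × ℝ^m`. -/
def lap {m : ℕ} (f : Spc m → ℂ) (x : Spc m) : ℂ :=
  fderiv ℝ (fun y => fderiv ℝ f y ((1 : ℝ), 0)) x ((1 : ℝ), 0)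
  + ∑ i : Fin m, fderiv ℝ (fun y => fderiv ℝ f y (0, EuclideanSpace.single i (1 : ℝ))) x
      (0, EuclideanSpace.single i (1 : ℝ))

section RealEstimate

variable {V ι : Type*} [NormedAddCommGroup V] [NormedSpace ℝ V] [Fintype ι]

/-- The squared Euclidean length in the coordinates of a basis. -/
def sqLength (b : Module.Basis ι ℝ V) (x : V) : ℝ := ∑ i, b.repr x i ^ 2

/-- The Laplacian in the coordinates of a basis. -/
def basisLaplacian (b : Module.Basis ι ℝ V) (h : V → ℝ) (x : V) : ℝ :=
  ∑ i, fderiv ℝ (fun y => fderiv ℝ h y (b i)) x (b i)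

/-- The shifted Euler operator `x · ∇h - (τ - d / 2) h`. -/
def eulerShift (b : Module.Basis ι ℝ V) (τ : ℝ) (h : V → ℝ) (x : V) : ℝ :=
  ∑ i, b.repr x i * fderiv ℝ h x (b i) - (τ - Fintype.card ι / 2) * h x

/-- Components of the vector field whose divergence gives the multiplier identity. -/
def multiplierField (b : Module.Basis ι ℝ V) (τ : ℝ) (h : V → ℝ) (j : ι) (x : V) : ℝ :=
  sqLength b x ^ (-τ) * (sqLength b x * (fderiv ℝ h x (b j) * eulerShift b τ h x
    - 1 / 2 * (b.repr x j * ∑ i, fderiv ℝ h x (b i) ^ 2))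
    + (τ - Fintype.card ι / 2) * (τ - 1) * (b.repr x j * h x ^ 2))

/-- Components of the vector field whose divergence gives the radial Poincaré inequality. -/
def radialField (b : Module.Basis ι ℝ V) (τ : ℝ) (h : V → ℝ) (j : ι) (x : V) : ℝ :=
  sqLength b x ^ (-τ) * (sqLength b x * (1 / 2 * (b.repr x j * h x ^ 2)))

theorem sum_multiplier_terms (x p : ι → ℝ) (H : ι → ι → ℝ) (hH : ∀ i j, H i j = H j i)
    (τ l h w : ℝ) (hl : l = τ - Fintype.card ι / 2) :
    ∑ j, (-2 * τ * x j * w * ((∑ i, x i ^ 2) * (p j * (∑ i, x i * p i - l * h)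
        - 1 / 2 * (x j * ∑ i, p i ^ 2)) + l * (τ - 1) * (x j * h ^ 2))
      + w * (∑ i, x i ^ 2) * (2 * x j * (p j * (∑ i, x i * p i - l * h)
        - 1 / 2 * (x j * ∑ i, p i ^ 2))
        + (∑ i, x i ^ 2) * (H j j * (∑ i, x i * p i - l * h)
          + p j * (p j + ∑ i, x i * H i j - l * p j)
          - 1 / 2 * (∑ i, p i ^ 2 + x j * ∑ i, 2 * p i * H i j))
        + l * (τ - 1) * (h ^ 2 + 2 * x j * h * p j)))
      = w * (∑ i, x i ^ 2) * ((∑ i, x i ^ 2) * (∑ i, H i i) * (∑ i, x i * p i - l * h)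
        - 2 * (τ - 1) * (∑ i, x i * p i - l * h) ^ 2) := by
  have hT : ∑ j, x j * ∑ i, 2 * p i * H i j = 2 * ∑ j, p j * ∑ i, x i * H i j := by
    simp only [Finset.mul_sum]
    rw [Finset.sum_comm]
    refine Finset.sum_congr rfl fun i _ => Finset.sum_congr rfl fun j _ => ?_
    rw [hH i j]; ring
  set R := ∑ i, x i ^ 2 with hR
  set E := ∑ i, x i * p i with hE
  set S := ∑ i, p i ^ 2 with hS
  set D := ∑ i, H i i with hD
  set T := ∑ j, p j * ∑ i, x i * H i j with hT'
  have key : ∀ j, (-2 * τ * x j * w * (R * (p j * (E - l * h)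
        - 1 / 2 * (x j * S)) + l * (τ - 1) * (x j * h ^ 2))
      + w * R * (2 * x j * (p j * (E - l * h) - 1 / 2 * (x j * S))
        + R * (H j j * (E - l * h) + p j * (p j + ∑ i, x i * H i j - l * p j)
          - 1 / 2 * (S + x j * ∑ i, 2 * p i * H i j))
        + l * (τ - 1) * (h ^ 2 + 2 * x j * h * p j)))
      = (-2 * τ * w * R * (E - l * h) + 2 * w * R * (E - l * h)
          + 2 * w * R * l * (τ - 1) * h) * (x j * p j)
        + (τ * w * R * S - 2 * τ * w * l * (τ - 1) * h ^ 2 - w * R * S) * x j ^ 2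
        + w * R * R * (E - l * h) * H j j + w * R * R * (1 - l) * p j ^ 2
        + w * R * R * (p j * ∑ i, x i * H i j)
        + (- 1 / 2 * w * R * R) * (x j * ∑ i, 2 * p i * H i j)
        + (w * R * l * (τ - 1) * h ^ 2 - 1 / 2 * w * R * R * S) := fun j => by ring
  rw [Finset.sum_congr rfl fun j _ => key j]
  simp only [Finset.sum_add_distrib, ← Finset.mul_sum, ← hR, ← hE, ← hS, ← hD, ← hT', hT,
    Finset.sum_const, Finset.card_univ, nsmul_eq_mul]
  have hc : (Fintype.card ι : ℝ) = 2 * (τ - l) := by rw [hl]; ring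
  rw [hc]
  ring

theorem sum_radial_terms (x p : ι → ℝ) (τ l h w : ℝ) (hl : l = τ - Fintype.card ι / 2) :
    ∑ j, (-2 * τ * x j * w * ((∑ i, x i ^ 2) * (1 / 2 * (x j * h ^ 2)))
      + w * (∑ i, x i ^ 2) * (2 * x j * (1 / 2 * (x j * h ^ 2))
        + (∑ i, x i ^ 2) * (1 / 2 * (h ^ 2 + 2 * x j * h * p j))))
      = w * (∑ i, x i ^ 2) * ((∑ i, x i ^ 2) * (h * (∑ i, x i * p i - l * h) + h ^ 2)) := by
  set R := ∑ i, x i ^ 2 with hR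
  set E := ∑ i, x i * p i with hE
  have key : ∀ j, (-2 * τ * x j * w * (R * (1 / 2 * (x j * h ^ 2)))
      + w * R * (2 * x j * (1 / 2 * (x j * h ^ 2))
        + R * (1 / 2 * (h ^ 2 + 2 * x j * h * p j))))
      = (1 - τ) * w * R * h ^ 2 * x j ^ 2 + w * R * R * h * (x j * p j)
        + 1 / 2 * w * R * R * h ^ 2 := fun j => by ring
  rw [Finset.sum_congr rfl fun j _ => key j]
  simp only [Finset.sum_add_distrib, ← Finset.mul_sum, ← hR, ← hE,
    Finset.sum_const, Finset.card_univ, nsmul_eq_mul]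
  have hc : (Fintype.card ι : ℝ) = 2 * (τ - l) := by rw [hl]; ring
  rw [hc]
  ring

variable [FiniteDimensional ℝ V] (b : Module.Basis ι ℝ V)

omit [Fintype ι] in
theorem hasFDerivAt_repr (i : ι) (x : V) :
    HasFDerivAt (fun y => b.repr y i) (LinearMap.toContinuousLinearMap (b.coord i)) x :=
  (LinearMap.toContinuousLinearMap (b.coord i)).hasFDerivAt

omit [Fintype ι] in
theorem contDiff_repr {n : WithTop ℕ∞} (i : ι) : ContDiff ℝ n (fun y => b.repr y i) :=
  (LinearMap.toContinuousLinearMap (b.coord i)).contDiff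

theorem contDiff_sqLength {n : WithTop ℕ∞} : ContDiff ℝ n (sqLength b) :=
  ContDiff.sum fun i _ => (contDiff_repr b i).pow 2

omit [FiniteDimensional ℝ V] in
theorem contDiff_fderiv_apply {h : V → ℝ} (hh : ContDiff ℝ 2 h) (v : V) :
    ContDiff ℝ 1 (fun y => fderiv ℝ h y v) :=
  (hh.fderiv_right (m := 1) (by norm_num)).clm_apply contDiff_const

variable {h : V → ℝ} (τ : ℝ)

theorem contDiff_eulerShift (hh : ContDiff ℝ 2 h) : ContDiff ℝ 1 (eulerShift b τ h) :=
  (ContDiff.sum fun i _ => (contDiff_repr b i).mul (contDiff_fderiv_apply hh (b i))).sub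
    (contDiff_const.mul (hh.of_le one_le_two))

theorem contDiffAt_multiplierField (hh : ContDiff ℝ 2 h) (j : ι) {x : V} (hx : sqLength b x ≠ 0) :
    ContDiffAt ℝ 1 (multiplierField b τ h j) x := by
  have h1 : ContDiffAt ℝ 1 (sqLength b) x := (contDiff_sqLength b).contDiffAt
  have h2 : ContDiff ℝ 1 (fun y => ∑ i, fderiv ℝ h y (b i) ^ 2) :=
    ContDiff.sum fun i _ => (contDiff_fderiv_apply hh (b i)).pow 2
  have h3 := hh.of_le one_le_two
  refine (h1.rpow_const_of_ne hx).mul ((h1.mul (ContDiff.contDiffAt ?_)).add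
    (ContDiff.contDiffAt ?_))
  · exact ((contDiff_fderiv_apply hh _).mul (contDiff_eulerShift b τ hh)).sub
      (contDiff_const.mul ((contDiff_repr b j).mul h2))
  · exact contDiff_const.mul ((contDiff_repr b j).mul (h3.pow 2))

theorem contDiffAt_radialField (hh : ContDiff ℝ 2 h) (j : ι) {x : V} (hx : sqLength b x ≠ 0) :
    ContDiffAt ℝ 1 (radialField b τ h j) x := by
  have h1 : ContDiffAt ℝ 1 (sqLength b) x := (contDiff_sqLength b).contDiffAt
  refine (h1.rpow_const_of_ne hx).mul (h1.mul (ContDiff.contDiffAt ?_))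
  exact contDiff_const.mul ((contDiff_repr b j).mul ((hh.of_le one_le_two).pow 2))

theorem divergence_multiplierField (hh : ContDiff ℝ 2 h) {x : V} (hx : sqLength b x ≠ 0) :
    ∑ j, fderiv ℝ (multiplierField b τ h j) x (b j)
      = sqLength b x ^ (-τ) * (sqLength b x * basisLaplacian b h x * eulerShift b τ h x
        - 2 * (τ - 1) * eulerShift b τ h x ^ 2) := by
  classical
  have hW : sqLength b x ^ (-τ) = sqLength b x ^ (-τ - 1) * sqLength b x := by
    rw [← Real.rpow_add_one hx, sub_add_cancel]
  have hsym : ∀ i j, fderiv ℝ (fun y => fderiv ℝ h y (b i)) x (b j)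
      = fderiv ℝ (fun y => fderiv ℝ h y (b j)) x (b i) := by
    have hd : DifferentiableAt ℝ (fderiv ℝ h) x :=
      (hh.fderiv_right (m := 1) (by norm_num)).differentiable one_ne_zero x
    intro i j
    rw [fderiv_clm_apply hd (by fun_prop), fderiv_clm_apply hd (by fun_prop)]
    simpa using hh.contDiffAt.isSymmSndFDerivAt (by simp) (b j) (b i)
  rw [hW]
  have key := sum_multiplier_terms (fun i => b.repr x i) (fun i => fderiv ℝ h x (b i))
    (fun i j => fderiv ℝ (fun y => fderiv ℝ h y (b i)) x (b j)) hsym τ _ (h x)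
    (sqLength b x ^ (-τ - 1)) rfl
  refine Eq.trans (Finset.sum_congr rfl fun j _ => ?_) key
  have dR : HasFDerivAt (sqLength b) _ x :=
    HasFDerivAt.fun_sum fun i _ => (hasFDerivAt_repr b i x).pow 2
  have dh : HasFDerivAt h _ x := (hh.differentiable two_ne_zero x).hasFDerivAt
  have dp : ∀ i, HasFDerivAt (fun y => fderiv ℝ h y (b i)) _ x := fun i =>
    ((contDiff_fderiv_apply hh (b i)).differentiable one_ne_zero x).hasFDerivAt
  have dS : HasFDerivAt (fun y => ∑ i, fderiv ℝ h y (b i) ^ 2) _ x :=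
    HasFDerivAt.fun_sum fun i _ => (dp i).pow 2
  have dN : HasFDerivAt (eulerShift b τ h) _ x :=
    (HasFDerivAt.fun_sum fun i _ => (hasFDerivAt_repr b i x).fun_mul (dp i)).fun_sub
      (dh.const_mul _)
  have dF : HasFDerivAt (multiplierField b τ h j) _ x :=
    (dR.rpow_const (Or.inl hx)).fun_mul ((dR.fun_mul (((dp j).fun_mul dN).fun_sub
      (((hasFDerivAt_repr b j x).fun_mul dS).const_mul _))).fun_add
      (((hasFDerivAt_repr b j x).fun_mul (dh.pow 2)).const_mul _))
  rw [dF.fderiv]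
  simp [Finsupp.single_apply, hW, Finset.sum_add_distrib]
  simp only [sqLength, eulerShift]
  ring

theorem divergence_radialField (hh : ContDiff ℝ 2 h) {x : V} (hx : sqLength b x ≠ 0) :
    ∑ j, fderiv ℝ (radialField b τ h j) x (b j)
      = sqLength b x ^ (-τ) * (sqLength b x * (h x * eulerShift b τ h x + h x ^ 2)) := by
  classical
  have hW : sqLength b x ^ (-τ) = sqLength b x ^ (-τ - 1) * sqLength b x := by
    rw [← Real.rpow_add_one hx, sub_add_cancel]
  rw [hW]
  have key := sum_radial_terms (fun i => b.repr x i) (fun i => fderiv ℝ h x (b i)) τ _ (h x)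
    (sqLength b x ^ (-τ - 1)) rfl
  refine Eq.trans (Finset.sum_congr rfl fun j _ => ?_) key
  have dR : HasFDerivAt (sqLength b) _ x :=
    HasFDerivAt.fun_sum fun i _ => (hasFDerivAt_repr b i x).pow 2
  have dh : HasFDerivAt h _ x := (hh.differentiable two_ne_zero x).hasFDerivAt
  have dF : HasFDerivAt (radialField b τ h j) _ x :=
    (dR.rpow_const (Or.inl hx)).fun_mul
      (dR.fun_mul (((hasFDerivAt_repr b j x).fun_mul (dh.pow 2)).const_mul _))
  rw [dF.fderiv]
  simp [Finsupp.single_apply, hW]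
  simp only [sqLength]
  ring


omit [FiniteDimensional ℝ V] in
theorem contDiff_of_contDiffAt_tsupport {f : V → ℝ} (h0 : ∀ x ∉ tsupport h, f x = 0)
    (h1 : ∀ x ∈ tsupport h, ContDiffAt ℝ 1 f x) : ContDiff ℝ 1 f := by
  refine contDiff_iff_contDiffAt.2 fun x => ?_
  by_cases hx : x ∈ tsupport h
  · exact h1 x hx
  · have : f =ᶠ[nhds x] fun _ => 0 := by
      filter_upwards [(isClosed_tsupport h).isOpen_compl.mem_nhds hx] with y hy using h0 y hy
    exact contDiffAt_const.congr_of_eventuallyEq this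

theorem integral_fderiv_apply_eq_zero [MeasurableSpace V] [BorelSpace V] (μ : Measure V)
    [μ.IsAddHaarMeasure] {f : V → ℝ} (hf : ContDiff ℝ 1 f) (hc : HasCompactSupport f) (v : V) :
    Integrable (fun x => fderiv ℝ f x v) μ ∧ ∫ x, fderiv ℝ f x v ∂μ = 0 := by
  have hi : Integrable (fun x => fderiv ℝ f x v) μ :=
    ((hf.continuous_fderiv one_ne_zero).clm_apply continuous_const).integrable_of_hasCompactSupport
      (hc.fderiv_apply ℝ v)
  refine ⟨hi, ?_⟩
  have := integral_mul_fderiv_eq_neg_fderiv_mul_of_integrable (μ := μ) (f := fun _ => (1 : ℝ))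
    (g := f) (v := v) (by simp) (by simpa using hi)
    (by simpa using hf.continuous.integrable_of_hasCompactSupport hc)
    (fun x _ => by fun_prop) (fun x _ => hf.differentiable one_ne_zero x)
  simpa using this

theorem integral_divergence_eq_zero [MeasurableSpace V] [BorelSpace V] (μ : Measure V)
    [μ.IsAddHaarMeasure] {F : ι → V → ℝ} (hc : HasCompactSupport h)
    (h0 : ∀ j, ∀ x ∉ tsupport h, F j x = 0) (h1 : ∀ j, ∀ x ∈ tsupport h, ContDiffAt ℝ 1 (F j) x) :
    Integrable (fun x => ∑ j, fderiv ℝ (F j) x (b j)) μ ∧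
      ∫ x, ∑ j, fderiv ℝ (F j) x (b j) ∂μ = 0 := by
  have key := fun j => integral_fderiv_apply_eq_zero μ
    (contDiff_of_contDiffAt_tsupport (h0 j) (h1 j)) (HasCompactSupport.intro hc (h0 j)) (b j)
  refine ⟨integrable_finsetSum _ fun j _ => (key j).1, ?_⟩
  rw [integral_finsetSum _ fun j _ => (key j).1]
  exact Finset.sum_eq_zero fun j _ => (key j).2

omit [FiniteDimensional ℝ V] [Fintype ι] in
theorem fderiv_apply_eq_zero_of_notMem_tsupport {x : V} (hx : x ∉ tsupport h) (v : V) :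
    fderiv ℝ h x v = 0 := by
  rw [image_eq_zero_of_notMem_tsupport fun hx' => hx (tsupport_fderiv_subset ℝ hx')]
  rfl

omit [FiniteDimensional ℝ V] in
theorem multiplierField_eq_zero (j : ι) {x : V} (hx : x ∉ tsupport h) :
    multiplierField b τ h j x = 0 := by
  simp [multiplierField, image_eq_zero_of_notMem_tsupport hx,
    fderiv_apply_eq_zero_of_notMem_tsupport hx]

omit [FiniteDimensional ℝ V] in
theorem radialField_eq_zero (j : ι) {x : V} (hx : x ∉ tsupport h) :
    radialField b τ h j x = 0 := by
  simp [radialField, image_eq_zero_of_notMem_tsupport hx]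

omit [FiniteDimensional ℝ V] in
theorem basisLaplacian_eq_zero {x : V} (hx : x ∉ tsupport h) : basisLaplacian b h x = 0 := by
  refine Finset.sum_eq_zero fun j _ => fderiv_apply_eq_zero_of_notMem_tsupport (fun hx' => hx ?_) _
  exact tsupport_fderiv_apply_subset ℝ (b j) hx'

theorem weighted_inequality {τ m M R W h N L : ℝ} (hτ : 2 ≤ |τ|) (hm : 0 < m) (hmR : m ≤ R)
    (hRM : R ≤ M) (hW : 0 ≤ W) :
    τ ^ 2 * m * (W * h ^ 2) ≤ M ^ 3 * (W * L ^ 2)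
      + 8 * (τ - 1) ^ 2 * (W * (R * (h * N + h ^ 2)))
      - 4 * (τ - 1) * M * (W * (R * L * N - 2 * (τ - 1) * N ^ 2)) := by
  have hs : τ ^ 2 ≤ 4 * (τ - 1) ^ 2 := by
    rcases le_abs.1 hτ with h1 | h1 <;> nlinarith
  have hM : 0 < M := by linarith
  have hR : 0 < R := by linarith
  have h1 : τ ^ 2 * m * h ^ 2 ≤ 4 * (τ - 1) ^ 2 * R * h ^ 2 := by gcongr
  have h2 : R * -(2 * (h * N) + h ^ 2) ≤ M * N ^ 2 := by
    have : R * N ^ 2 ≤ M * N ^ 2 := by gcongr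
    nlinarith [mul_nonneg hR.le (sq_nonneg (h + N))]
  have h3 : R ^ 2 * L ^ 2 ≤ M ^ 2 * L ^ 2 := by gcongr
  have h4 : 4 * (τ - 1) * (R * L * N) ≤ M ^ 2 * L ^ 2 + 4 * ((τ - 1) ^ 2 * N ^ 2) := by
    nlinarith [sq_nonneg (R * L - 2 * (τ - 1) * N)]
  have h5 : 4 * (τ - 1) ^ 2 * (R * -(2 * (h * N) + h ^ 2)) ≤ 4 * (τ - 1) ^ 2 * (M * N ^ 2) := by
    gcongr
  have h6 := mul_le_mul_of_nonneg_left h4 hM.le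
  have h7 : τ ^ 2 * m * h ^ 2 ≤ M ^ 3 * L ^ 2 + 8 * (τ - 1) ^ 2 * (R * (h * N + h ^ 2))
      - 4 * (τ - 1) * M * (R * L * N - 2 * (τ - 1) * N ^ 2) := by
    linarith
  have := mul_le_mul_of_nonneg_left h7 hW
  linarith

theorem integrable_weight_mul_sq [MeasurableSpace V] [BorelSpace V] (μ : Measure V)
    [μ.IsAddHaarMeasure] (hc : HasCompactSupport h) (hρ : ∀ x ∈ tsupport h, sqLength b x ≠ 0)
    {g : V → ℝ} (hg : Continuous g) (h0 : ∀ x ∉ tsupport h, g x = 0) :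
    Integrable (fun x => sqLength b x ^ (-τ) * g x ^ 2) μ := by
  have hz : ∀ x ∉ tsupport h, sqLength b x ^ (-τ) * g x ^ 2 = 0 := fun x hx => by simp [h0 x hx]
  refine Continuous.integrable_of_hasCompactSupport ?_ (HasCompactSupport.intro hc hz)
  refine continuous_iff_continuousAt.2 fun x => ?_
  by_cases hx : x ∈ tsupport h
  · exact ((contDiff_sqLength b (n := 0)).continuous.continuousAt.rpow_const
      (Or.inl (hρ x hx))).mul (hg.pow 2).continuousAt
  · refine (continuousAt_const (y := (0 : ℝ))).congr ?_
    filter_upwards [(isClosed_tsupport h).isOpen_compl.mem_nhds hx] with y hy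
    exact (hz y hy).symm

omit [FiniteDimensional ℝ V] in
theorem continuous_basisLaplacian (hh : ContDiff ℝ 2 h) : Continuous (basisLaplacian b h) :=
  continuous_finsetSum _ fun j _ =>
    ((contDiff_fderiv_apply hh (b j)).continuous_fderiv one_ne_zero).clm_apply continuous_const

theorem weighted_estimate [MeasurableSpace V] [BorelSpace V] (μ : Measure V)
    [μ.IsAddHaarMeasure] (hh : ContDiff ℝ 2 h) (hc : HasCompactSupport h) {m M : ℝ} (hm : 0 < m)
    (hρ : ∀ x ∈ tsupport h, m ≤ sqLength b x ∧ sqLength b x ≤ M) (hτ : 2 ≤ |τ|) :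
    τ ^ 2 * m * ∫ x, sqLength b x ^ (-τ) * h x ^ 2 ∂μ
      ≤ M ^ 3 * ∫ x, sqLength b x ^ (-τ) * basisLaplacian b h x ^ 2 ∂μ := by
  have hne : ∀ x ∈ tsupport h, sqLength b x ≠ 0 := fun x hx => (hm.trans_le (hρ x hx).1).ne'
  obtain ⟨iF, eF⟩ := integral_divergence_eq_zero b μ (F := multiplierField b τ h) hc
    (fun j x hx => multiplierField_eq_zero b τ j hx)
    (fun j x hx => contDiffAt_multiplierField b τ hh j (hne x hx))
  obtain ⟨iH, eH⟩ := integral_divergence_eq_zero b μ (F := radialField b τ h) hc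
    (fun j x hx => radialField_eq_zero b τ j hx)
    (fun j x hx => contDiffAt_radialField b τ hh j (hne x hx))
  have ih := integrable_weight_mul_sq b τ μ hc hne hh.continuous
    fun x hx => image_eq_zero_of_notMem_tsupport hx
  have iL := integrable_weight_mul_sq b τ μ hc hne (continuous_basisLaplacian b hh)
    fun x hx => basisLaplacian_eq_zero b hx
  have hfd : ∀ {f : V → ℝ} {x : V}, (∀ y ∉ tsupport h, f y = 0) → x ∉ tsupport h →
      ∀ v, fderiv ℝ f x v = 0 := fun {f x} hf hx v => by
    have : f =ᶠ[nhds x] fun _ => 0 := by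
      filter_upwards [(isClosed_tsupport h).isOpen_compl.mem_nhds hx] with y hy using hf y hy
    rw [this.fderiv_eq]
    simp
  have pt : ∀ x, τ ^ 2 * m * (sqLength b x ^ (-τ) * h x ^ 2)
      ≤ M ^ 3 * (sqLength b x ^ (-τ) * basisLaplacian b h x ^ 2)
        + 8 * (τ - 1) ^ 2 * (∑ j, fderiv ℝ (radialField b τ h j) x (b j))
        - 4 * (τ - 1) * M * (∑ j, fderiv ℝ (multiplierField b τ h j) x (b j)) := by
    intro x
    by_cases hx : x ∈ tsupport h
    · rw [divergence_multiplierField b τ hh (hne x hx), divergence_radialField b τ hh (hne x hx)]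
      exact weighted_inequality hτ hm (hρ x hx).1 (hρ x hx).2
        (Real.rpow_nonneg (hm.le.trans (hρ x hx).1) _)
    · simp [image_eq_zero_of_notMem_tsupport hx, basisLaplacian_eq_zero b hx,
        hfd (fun y hy => radialField_eq_zero b τ _ hy) hx,
        hfd (fun y hy => multiplierField_eq_zero b τ _ hy) hx]
  have := integral_mono (ih.const_mul _)
    (((iL.const_mul (M ^ 3)).add (iH.const_mul (8 * (τ - 1) ^ 2))).sub
      (iF.const_mul (4 * (τ - 1) * M))) pt
  rw [integral_const_mul, integral_sub' ((iL.const_mul _).add (iH.const_mul _)) (iF.const_mul _),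
    integral_add' (iL.const_mul _) (iH.const_mul _), integral_const_mul, integral_const_mul,
    integral_const_mul, eF, eH] at this
  linarith

end RealEstimate

/-- The standard basis of `ℝ × ℝ^m`. -/
def spcBasis (m : ℕ) : Module.Basis (Unit ⊕ Fin m) ℝ (Spc m) :=
  (Module.Basis.singleton Unit ℝ).prod (EuclideanSpace.basisFun (Fin m) ℝ).toBasis

theorem norm_zbf_sq {m : ℕ} (x : Spc m) : ‖zbf x‖ ^ 2 = x.1 ^ 2 + ‖x.2‖ ^ 2 := by
  rw [← Complex.normSq_eq_norm_sq, Complex.normSq_apply]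
  simp [zbf]
  ring

theorem sqLength_spcBasis {m : ℕ} (x : Spc m) : sqLength (spcBasis m) x = ‖zbf x‖ ^ 2 := by
  simp [sqLength, spcBasis, norm_zbf_sq, EuclideanSpace.norm_sq_eq]

theorem basisLaplacian_clm_comp {m : ℕ} (L : ℂ →L[ℝ] ℝ) {H : Spc m → ℂ} (hH : ContDiff ℝ 2 H)
    (x : Spc m) : basisLaplacian (spcBasis m) (fun y => L (H y)) x = L (lap H x) := by
  have key : ∀ v, fderiv ℝ (fun y => fderiv ℝ (fun y => L (H y)) y v) x v
      = L (fderiv ℝ (fun y => fderiv ℝ H y v) x v) := by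
    intro v
    have h1 : ∀ y, fderiv ℝ (fun y => L (H y)) y v = L (fderiv ℝ H y v) := fun y =>
      DFunLike.congr_fun (HasFDerivAt.fderiv (f := fun y => L (H y))
        (L.hasFDerivAt.comp y (hH.differentiable two_ne_zero y).hasFDerivAt)) v
    have h2 : DifferentiableAt ℝ (fun y => fderiv ℝ H y v) x :=
      (((hH.fderiv_right (m := 1) (by norm_num)).clm_apply contDiff_const).differentiable
        one_ne_zero x)
    simp only [h1]
    exact DFunLike.congr_fun (HasFDerivAt.fderiv (f := fun y => L (fderiv ℝ H y v))
      (L.hasFDerivAt.comp x h2.hasFDerivAt)) v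
  simp [basisLaplacian, key, lap, spcBasis]

instance isAddHaarMeasure_volume_spc (m : ℕ) : (volume : Measure (Spc m)).IsAddHaarMeasure :=
  inferInstanceAs
    ((volume : Measure ℝ).prod (volume : Measure (EuclideanSpace ℝ (Fin m)))).IsAddHaarMeasure

theorem complex_weighted_estimate {k : ℕ} {H : Spc k → ℂ} (hH : ContDiff ℝ 2 H)
    (hc : HasCompactSupport H) {m M τ : ℝ} (hm : 0 < m)
    (hρ : ∀ x ∈ tsupport H, m ≤ ‖zbf x‖ ^ 2 ∧ ‖zbf x‖ ^ 2 ≤ M) (hτ : 2 ≤ |τ|) :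
    τ ^ 2 * m * ∫ x, (‖zbf x‖ ^ 2) ^ (-τ) * ‖H x‖ ^ 2
      ≤ M ^ 3 * ∫ x, (‖zbf x‖ ^ 2) ^ (-τ) * ‖lap H x‖ ^ 2 := by
  have comp : ∀ L : ℂ →L[ℝ] ℝ,
      τ ^ 2 * m * ∫ x, (‖zbf x‖ ^ 2) ^ (-τ) * L (H x) ^ 2
        ≤ M ^ 3 * ∫ x, (‖zbf x‖ ^ 2) ^ (-τ) * L (lap H x) ^ 2 ∧
      Integrable (fun x => (‖zbf x‖ ^ 2) ^ (-τ) * L (H x) ^ 2) ∧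
      Integrable (fun x => (‖zbf x‖ ^ 2) ^ (-τ) * L (lap H x) ^ 2) := by
    intro L
    have hL : ContDiff ℝ 2 (fun y => L (H y)) := L.contDiff.comp hH
    have hcL : HasCompactSupport (fun y => L (H y)) := hc.comp_left (map_zero L)
    have hs : tsupport (fun y => L (H y)) ⊆ tsupport H :=
      closure_mono fun x hx hx' => hx (by simp [hx'])
    have hne : ∀ x ∈ tsupport (fun y => L (H y)), sqLength (spcBasis k) x ≠ 0 := fun x hx => by
      rw [sqLength_spcBasis]
      exact (hm.trans_le (hρ x (hs hx)).1).ne'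
    have e := weighted_estimate (spcBasis k) τ volume hL hcL hm
      (fun x hx => by rw [sqLength_spcBasis]; exact hρ x (hs hx)) hτ
    have i1 := integrable_weight_mul_sq (spcBasis k) τ volume hcL hne hL.continuous
      fun x hx => image_eq_zero_of_notMem_tsupport (f := fun y => L (H y)) hx
    have i2 := integrable_weight_mul_sq (spcBasis k) τ volume hcL hne
      (continuous_basisLaplacian (spcBasis k) hL) fun x hx => basisLaplacian_eq_zero _ hx
    simp only [sqLength_spcBasis, basisLaplacian_clm_comp L hH] at e i1 i2
    exact ⟨e, i1, i2⟩
  have split : ∀ w : ℂ, ‖w‖ ^ 2 = reCLM w ^ 2 + imCLM w ^ 2 := fun w => by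
    rw [← Complex.normSq_eq_norm_sq, Complex.normSq_apply]
    simp only [reCLM_apply, imCLM_apply]
    ring
  obtain ⟨e1, i1, j1⟩ := comp reCLM
  obtain ⟨e2, i2, j2⟩ := comp imCLM
  simp only [fun x => split (H x), fun x => split (lap H x), mul_add]
  rw [integral_add i1 i2, integral_add j1 j2]
  linarith

theorem zbf_mem_slitPlane {m : ℕ} {x : Spc m} (hx : x.2 ≠ 0) : zbf x ∈ slitPlane := by
  refine Or.inr ?_
  simpa [zbf] using hx

theorem contDiffAt_zbf {m : ℕ} {n : WithTop ℕ∞} {x : Spc m} (hx : x.2 ≠ 0) :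
    ContDiffAt ℝ n zbf x := by
  have h1 : ContDiffAt ℝ n (fun y : Spc m => (y.1 : ℂ)) x :=
    (ofRealCLM.contDiff.comp contDiff_fst).contDiffAt
  have h2 : ContDiffAt ℝ n (fun y : Spc m => ((‖y.2‖ : ℝ) : ℂ)) x :=
    ofRealCLM.contDiff.contDiffAt.comp x (contDiff_snd.contDiffAt.norm ℝ hx)
  exact h1.sub (contDiffAt_const.mul h2)

theorem contDiff_zbf_cpow_mul {m : ℕ} {u : Spc m → ℂ} (τ : ℂ) (hu : ContDiff ℝ 2 u)
    (hs : ∀ x ∈ tsupport u, x.2 ≠ 0) : ContDiff ℝ 2 (fun y => zbf y ^ τ * u y) := by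
  refine contDiff_iff_contDiffAt.2 fun x => ?_
  by_cases hx : x ∈ tsupport u
  · have hz := zbf_mem_slitPlane (hs x hx)
    have h1 : ContDiffAt ℝ 2 (fun w : ℂ => w ^ τ) (zbf x) := by
      have : AnalyticAt ℂ (fun w : ℂ => w ^ τ) (zbf x) := analyticAt_id.cpow analyticAt_const hz
      exact this.contDiffAt.restrict_scalars ℝ
    exact (h1.comp x (contDiffAt_zbf (hs x hx))).mul hu.contDiffAt
  · have : (fun y => zbf y ^ τ * u y) =ᶠ[nhds x] fun _ => 0 := by
      filter_upwards [notMem_tsupport_iff_eventuallyEq.1 hx] with y hy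
      simp [hy]
    exact contDiffAt_const.congr_of_eventuallyEq this

theorem lap_eq_zero_of_notMem_tsupport {m : ℕ} {H : Spc m → ℂ} {x : Spc m}
    (hx : x ∉ tsupport H) : lap H x = 0 := by
  have key : ∀ v, fderiv ℝ (fun y => fderiv ℝ H y v) x v = 0 := fun v => by
    rw [image_eq_zero_of_notMem_tsupport fun hx' => hx (tsupport_fderiv_apply_subset ℝ v
      (tsupport_fderiv_subset ℝ hx'))]
    rfl
  simp [lap, key]

theorem norm_cpow_neg_mul_sq {z : ℂ} (τ : ℝ) (w : ℂ) :
    ‖z ^ (-(τ : ℂ)) * w‖ ^ 2 = (‖z‖ ^ 2) ^ (-τ) * ‖w‖ ^ 2 := by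
  rw [norm_mul, mul_pow, ← ofReal_neg, Complex.norm_cpow_real,
    ← Real.rpow_pow_comm (norm_nonneg z)]

/-- Interior Carleman estimate for the conjugated Laplacian `z̄^{-τ} Δ z̄^{τ}`. -/
theorem carleman_estimate_conj (n : ℕ) (hn : 3 ≤ n) (Ω : Set (Spc (n - 1)))
    (hΩopen : IsOpen Ω) (hΩne : Ω.Nonempty) (hΩbdd : Bornology.IsBounded Ω)
    (hΩline : ∀ x ∈ closure Ω, x.2 ≠ 0) :
    ∃ C > (0 : ℝ), ∃ τ₀ ≥ (1 : ℝ), ∀ τ : ℝ, τ₀ ≤ |τ| →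
      ∀ u : Spc (n - 1) → ℂ, ContDiff ℝ (⊤ : ℕ∞) u → HasCompactSupport u → tsupport u ⊆ Ω →
        |τ| * Real.sqrt (∫ x in Ω, ‖u x‖ ^ 2) ≤
          C * Real.sqrt (∫ x in Ω,
            ‖zbf x ^ (-(τ : ℂ)) * lap (fun y => zbf y ^ (τ : ℂ) * u y) x‖ ^ 2) := by
  have hcpt : IsCompact (closure Ω) := hΩbdd.isCompact_closure
  have hcont : Continuous (fun x : Spc (n - 1) => ‖zbf x‖ ^ 2) := by
    unfold zbf
    fun_prop
  have hzne : ∀ x ∈ closure Ω, zbf x ≠ 0 := fun x hx =>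
    slitPlane_ne_zero (zbf_mem_slitPlane (hΩline x hx))
  obtain ⟨p, hp, hpmin⟩ := hcpt.exists_isMinOn hΩne.closure hcont.continuousOn
  obtain ⟨q, hq, hqmax⟩ := hcpt.exists_isMaxOn hΩne.closure hcont.continuousOn
  set m := ‖zbf p‖ ^ 2
  set M := ‖zbf q‖ ^ 2
  have hm : 0 < m := by have := norm_pos_iff.2 (hzne p hp); positivity
  have hM : 0 < M := by have := norm_pos_iff.2 (hzne q hq); positivity
  refine ⟨Real.sqrt (M ^ 3 / m), by positivity, 2, one_le_two, fun τ hτ u hu hc hs => ?_⟩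
  have hsub : tsupport u ⊆ closure Ω := hs.trans subset_closure
  set H : Spc (n - 1) → ℂ := fun y => zbf y ^ (τ : ℂ) * u y with hHdef
  have hH : ContDiff ℝ 2 H := contDiff_zbf_cpow_mul τ (contDiff_infty.1 hu 2)
    fun x hx => hΩline x (hsub hx)
  have hHs : tsupport H ⊆ tsupport u := closure_mono fun x hx hx' => hx (by simp [hHdef, hx'])
  have hHc : HasCompactSupport H := hc.mul_left
  have est := complex_weighted_estimate hH hHc hm
    (fun x hx => ⟨hpmin (hsub (hHs hx)), hqmax (hsub (hHs hx))⟩) hτ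
  have eu : ∫ x in Ω, ‖u x‖ ^ 2 = ∫ x, (‖zbf x‖ ^ 2) ^ (-τ) * ‖H x‖ ^ 2 := by
    rw [setIntegral_eq_integral_of_forall_compl_eq_zero fun x hx => by
      simp [image_eq_zero_of_notMem_tsupport fun hx' => hx (hs hx')]]
    refine integral_congr_ae (.of_forall fun x => ?_)
    by_cases hx : x ∈ tsupport u
    · simp only
      rw [← norm_cpow_neg_mul_sq, hHdef, cpow_neg,
        inv_mul_cancel_left₀ (by simp [cpow_eq_zero_iff, hzne x (hsub hx)])]
    · simp [hHdef, image_eq_zero_of_notMem_tsupport hx]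
  have eL : ∫ x in Ω, ‖zbf x ^ (-(τ : ℂ)) * lap H x‖ ^ 2
      = ∫ x, (‖zbf x‖ ^ 2) ^ (-τ) * ‖lap H x‖ ^ 2 := by
    rw [setIntegral_eq_integral_of_forall_compl_eq_zero fun x hx => by
      simp [lap_eq_zero_of_notMem_tsupport fun hx' => hx (hs (hHs hx'))]]
    simp only [norm_cpow_neg_mul_sq]
  rw [eu, eL, ← Real.sqrt_mul (by positivity), ← Real.sqrt_sq_eq_abs,
    ← Real.sqrt_mul (sq_nonneg τ)]
  refine Real.sqrt_le_sqrt ?_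
  rw [div_mul_eq_mul_div, le_div_iff₀ hm]
  linarith
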